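/- For every integer d ≥ 1 and every real α with 0 < α < 2, the rescaled symbol converges at the origin: lim_{u → 0, u ∈ R^d∖{0}} Σ_{y ∈ Z^d, y ≠ 0} (1 − cos(u·y)) / ( ‖y‖₂^{d+α} · ‖u‖₂^{α} ) = G̃^{d,α}, where G̃^{d,α} = ∫_{R^d} (1 − cos v₁)/‖v‖₂^{d+α} dv. -/

import Mathlib

open MeasureTheory Filter Real Topology

/-- Euclidean (l²) norm of a vector in `Fin d → ℝ`. -/
noncomputable def l2norm {d : ℕ} (u : Fin d → ℝ) : ℝ := Real.sqrt (∑ i, u i ^ 2)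

/-- Euclidean norm of a lattice point. -/
noncomputable def zl2 {d : ℕ} (y : Fin d → ℤ) : ℝ := l2norm (fun i => (y i : ℝ))

/-- The symbol `Σ_{y ≠ 0} (cos(θ·y) − 1)/‖y‖₂^{d+α}` of the long-range random walk. -/
noncomputable def latticeSymbol (d : ℕ) (α : ℝ) (θ : Fin d → ℝ) : ℝ :=
  ∑' y : {y : Fin d → ℤ // y ≠ 0},
    (Real.cos (∑ i, θ i * (y.1 i : ℝ)) - 1) / zl2 y.1 ^ ((d : ℝ) + α)

/-- Transition probability `p_t^{d,α}(0,x)` of the long-range random walk, defined through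
the Fourier inversion formula. -/
noncomputable def pTrans (d : ℕ) (α : ℝ) (t : ℝ) (x : Fin d → ℤ) : ℝ :=
  ((2 * Real.pi) ^ d)⁻¹ *
    ∫ θ in Set.univ.pi (fun _ : Fin d => Set.Icc (-Real.pi) Real.pi),
      Real.exp (t * latticeSymbol d α θ) * Real.cos (∑ i, (x i : ℝ) * θ i)

/-- The constant `G̃^{d,α} = ∫_{R^d} (1 − cos v₁)/‖v‖₂^{d+α} dv`. -/
noncomputable def Gtilde (d : ℕ) (α : ℝ) : ℝ :=
  ∫ v : Fin d → ℝ, (1 - Real.cos (if h : 0 < d then v ⟨0, h⟩ else 0)) / l2norm v ^ ((d : ℝ) + α)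

/-- The density `f_t^{d,α}` of the limiting stable law (case `0 < α < 2`). -/
noncomputable def fDensity (d : ℕ) (α : ℝ) (t : ℝ) (u : Fin d → ℝ) : ℝ :=
  ((2 * Real.pi) ^ d)⁻¹ *
    ∫ θ : Fin d → ℝ, Real.cos (∑ i, θ i * u i) * Real.exp (-(t * l2norm θ ^ α * Gtilde d α))

theorem l2norm_eq_norm_toLp {d : ℕ} (v : Fin d → ℝ) : l2norm v = ‖WithLp.toLp 2 v‖ := by
  simp [l2norm, EuclideanSpace.norm_eq]

theorem continuous_l2norm {d : ℕ} : Continuous (l2norm : (Fin d → ℝ) → ℝ) := by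
  unfold l2norm
  fun_prop

theorem l2norm_nonneg {d : ℕ} (v : Fin d → ℝ) : 0 ≤ l2norm v := Real.sqrt_nonneg _

theorem l2norm_pos {d : ℕ} {v : Fin d → ℝ} (hv : v ≠ 0) : 0 < l2norm v := by
  rw [l2norm_eq_norm_toLp, norm_pos_iff]
  simpa using hv

theorem l2norm_smul {d : ℕ} (r : ℝ) (v : Fin d → ℝ) : l2norm (r • v) = |r| * l2norm v := by
  rw [l2norm_eq_norm_toLp, l2norm_eq_norm_toLp, WithLp.toLp_smul, norm_smul, Real.norm_eq_abs]

theorem l2norm_normalize {d : ℕ} {u : Fin d → ℝ} (hu : u ≠ 0) : l2norm ((l2norm u)⁻¹ • u) = 1 := by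
  have h := l2norm_pos hu
  rw [l2norm_smul, abs_of_pos (inv_pos.2 h), inv_mul_cancel₀ h.ne']

theorem norm_le_l2norm {d : ℕ} (v : Fin d → ℝ) : ‖v‖ ≤ l2norm v := by
  refine (pi_norm_le_iff_of_nonneg (l2norm_nonneg v)).2 fun i => ?_
  rw [l2norm_eq_norm_toLp]
  exact PiLp.norm_apply_le (WithLp.toLp 2 v) i

theorem abs_sum_mul_le_l2norm_mul {d : ℕ} (u v : Fin d → ℝ) :
    |∑ i, u i * v i| ≤ l2norm u * l2norm v := by
  have h := abs_real_inner_le_norm (WithLp.toLp 2 v) (WithLp.toLp 2 u)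
  rw [l2norm_eq_norm_toLp, l2norm_eq_norm_toLp, mul_comm]
  simpa [PiLp.inner_apply] using h

/-- The integrand `(1 − cos(ω·v))/‖v‖₂^p`. -/
noncomputable def waveIntegrand {d : ℕ} (p : ℝ) (ω v : Fin d → ℝ) : ℝ :=
  (1 - Real.cos (∑ i, ω i * v i)) / l2norm v ^ p

theorem measurable_waveIntegrand {d : ℕ} (p : ℝ) (ω : Fin d → ℝ) :
    Measurable (waveIntegrand p ω) := by
  have := (continuous_l2norm (d := d)).measurable
  unfold waveIntegrand
  fun_prop

theorem waveIntegrand_zero {d : ℕ} (p : ℝ) (ω : Fin d → ℝ) : waveIntegrand p ω 0 = 0 := by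
  simp [waveIntegrand]

theorem waveIntegrand_nonneg {d : ℕ} (p : ℝ) (ω v : Fin d → ℝ) : 0 ≤ waveIntegrand p ω v :=
  div_nonneg (sub_nonneg.2 (Real.cos_le_one _)) (Real.rpow_nonneg (l2norm_nonneg v) _)

theorem waveIntegrand_le_two_mul_rpow {d : ℕ} (p : ℝ) {β : ℝ} (hβ0 : 0 ≤ β) (hβ2 : β ≤ 2)
    {ω : Fin d → ℝ} (hω : l2norm ω = 1) {v : Fin d → ℝ} (hv : v ≠ 0) :
    waveIntegrand p ω v ≤ 2 * l2norm v ^ (-(p - β)) := by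
  have ht := l2norm_pos hv
  set t := l2norm v
  have hnum : 1 - Real.cos (∑ i, ω i * v i) ≤ 2 * t ^ β := by
    rcases le_total t 1 with h | h
    · have h1 := abs_sum_mul_le_l2norm_mul ω v
      rw [hω, one_mul] at h1
      have h2 := Real.one_sub_sq_div_two_le_cos (x := ∑ i, ω i * v i)
      have h3 : (∑ i, ω i * v i) ^ 2 ≤ t ^ 2 := sq_le_sq' (abs_le.1 h1).1 (abs_le.1 h1).2
      have h4 : t ^ (2 : ℝ) ≤ t ^ β := Real.rpow_le_rpow_of_exponent_ge ht h hβ2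
      rw [Real.rpow_two] at h4
      nlinarith [sq_nonneg t]
    · have := Real.neg_one_le_cos (∑ i, ω i * v i)
      have := Real.one_le_rpow h hβ0
      linarith
  rw [waveIntegrand, div_le_iff₀ (Real.rpow_pos_of_pos ht _), mul_assoc, ← Real.rpow_add ht]
  convert! hnum using 3
  ring

/-- A radial majorant of `waveIntegrand`, stable under perturbing its argument by a factor `2`. -/
theorem waveIntegrand_le_majorant {d : ℕ} {p β : ℝ} (hβ0 : 0 ≤ β) (hβ2 : β ≤ 2) (hp : β ≤ p)
    {ω : Fin d → ℝ} (hω : l2norm ω = 1) {v w : Fin d → ℝ} (hv : v ≠ 0)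
    (hvw : w ≠ 0 → ‖v‖ ≤ 2 * ‖w‖) :
    waveIntegrand p ω w ≤ 2 * 2 ^ p * min (‖v‖ ^ (-p)) (‖v‖ ^ (-(p - β))) := by
  have hv' : 0 < ‖v‖ := norm_pos_iff.2 hv
  rcases eq_or_ne w 0 with rfl | hw
  · rw [waveIntegrand_zero]; positivity
  have hle : ‖v‖ / 2 ≤ l2norm w := by
    have := hvw hw
    have := norm_le_l2norm w
    linarith
  have key : ∀ γ, 0 ≤ γ → γ ≤ 2 → γ ≤ p →
      waveIntegrand p ω w ≤ 2 * 2 ^ p * ‖v‖ ^ (-(p - γ)) := fun γ h0 h2 hγ => by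
    refine (waveIntegrand_le_two_mul_rpow p h0 h2 hω hw).trans ?_
    rw [mul_assoc]
    refine mul_le_mul_of_nonneg_left ?_ zero_le_two
    calc l2norm w ^ (-(p - γ)) ≤ (‖v‖ / 2) ^ (-(p - γ)) :=
          Real.rpow_le_rpow_of_nonpos (by positivity) hle (by linarith)
      _ = 2 ^ (p - γ) * ‖v‖ ^ (-(p - γ)) := by
          rw [Real.div_rpow hv'.le zero_le_two, Real.rpow_neg zero_le_two, div_inv_eq_mul, mul_comm]
      _ ≤ 2 ^ p * ‖v‖ ^ (-(p - γ)) := by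
          gcongr
          · norm_num
          · linarith
  rw [mul_min_of_nonneg _ _ (by positivity)]
  refine le_min ?_ (key β hβ0 hβ2 hp)
  simpa using key 0 le_rfl zero_le_two (hβ0.trans hp)

theorem integrable_min_norm_rpow {d : ℕ} (hd : 1 ≤ d) {p q : ℝ} (hp : d < p) (hq : q < d) :
    Integrable fun v : Fin d → ℝ => min (‖v‖ ^ (-p)) (‖v‖ ^ (-q)) := by
  have : NeZero d := ⟨by omega⟩
  rw [integrable_fun_norm_addHaar volume (f := fun t : ℝ => min (t ^ (-p)) (t ^ (-q)))]
  have hmeas : Measurable fun t : ℝ => t ^ (Module.finrank ℝ (Fin d → ℝ) - 1) •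
      min (t ^ (-p)) (t ^ (-q)) := by fun_prop
  have key : ∀ s, ∀ t : ℝ, 0 < t → t ^ (d - 1) * t ^ (-s) = t ^ ((d : ℝ) - 1 - s) := by
    intro s t ht
    rw [← Real.rpow_natCast, ← Real.rpow_add ht, Nat.cast_sub hd]
    simp [sub_eq_add_neg]
  rw [← Set.Ioc_union_Ioi_eq_Ioi (zero_le_one (α := ℝ))]
  refine IntegrableOn.union ?_ ?_
  · have h : IntegrableOn (fun t : ℝ => t ^ ((d : ℝ) - 1 - q)) (Set.Ioc 0 1) := by
      rw [← intervalIntegrable_iff_integrableOn_Ioc_of_le zero_le_one]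
      exact intervalIntegral.intervalIntegrable_rpow' (by linarith)
    refine h.mono' hmeas.aestronglyMeasurable ?_
    refine (ae_restrict_iff' measurableSet_Ioc).2 (.of_forall fun t ht => ?_)
    have ht0 : 0 < t := ht.1
    rw [Real.norm_of_nonneg (by positivity), smul_eq_mul, Module.finrank_fin_fun, ← key q t ht0]
    gcongr
    exact min_le_right _ _
  · have h : IntegrableOn (fun t : ℝ => t ^ ((d : ℝ) - 1 - p)) (Set.Ioi 1) :=
      integrableOn_Ioi_rpow_of_lt (by linarith) one_pos
    refine h.mono' hmeas.aestronglyMeasurable ?_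
    refine (ae_restrict_iff' measurableSet_Ioi).2 (.of_forall fun t ht => ?_)
    have ht0 : 0 < t := one_pos.trans ht
    rw [Real.norm_of_nonneg (by positivity), smul_eq_mul, Module.finrank_fin_fun, ← key p t ht0]
    gcongr
    exact min_le_left _ _

/-- By rotation invariance the integral of `waveIntegrand` does not depend on the direction. -/
theorem integral_waveIntegrand_eq {d : ℕ} (p : ℝ) {ω ω' : Fin d → ℝ} (h : l2norm ω = l2norm ω') :
    ∫ v, waveIntegrand p ω v = ∫ v, waveIntegrand p ω' v := by
  have hnorm : ‖WithLp.toLp 2 ω‖ = ‖WithLp.toLp 2 ω'‖ := by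
    rwa [l2norm_eq_norm_toLp, l2norm_eq_norm_toLp] at h
  let R := (ℝ ∙ (WithLp.toLp 2 ω - WithLp.toLp 2 ω'))ᗮ.reflection
  have hR : R (WithLp.toLp 2 ω) = WithLp.toLp 2 ω' := Submodule.reflection_sub hnorm
  have hvol := EuclideanSpace.volume_preserving_symm_measurableEquiv_toLp (Fin d)
  have hform : ∀ (η : Fin d → ℝ) (x : EuclideanSpace ℝ (Fin d)),
      waveIntegrand p η ((MeasurableEquiv.toLp 2 (Fin d → ℝ)).symm x) =
        (1 - Real.cos (inner ℝ (WithLp.toLp 2 η) x)) / ‖x‖ ^ p := by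
    intro η x
    simp [waveIntegrand, l2norm_eq_norm_toLp, PiLp.inner_apply, mul_comm]
  rw [← hvol.integral_comp' (g := waveIntegrand p ω),
    ← hvol.integral_comp' (g := waveIntegrand p ω')]
  simp_rw [hform]
  rw [← R.measurePreserving.integral_comp R.toHomeomorph.measurableEmbedding
    fun x => (1 - Real.cos (inner ℝ (WithLp.toLp 2 ω') x)) / ‖x‖ ^ p]
  simp_rw [← hR, LinearIsometryEquiv.inner_map_map, LinearIsometryEquiv.norm_map]

theorem Gtilde_eq_integral_waveIntegrand {d : ℕ} (hd : 1 ≤ d) (α : ℝ) {ω : Fin d → ℝ}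
    (hω : l2norm ω = 1) : Gtilde d α = ∫ v, waveIntegrand (d + α) ω v := by
  have hd' : 0 < d := hd
  rw [integral_waveIntegrand_eq (d + α) (ω' := Pi.single ⟨0, hd'⟩ 1)]
  · simp [Gtilde, waveIntegrand, hd', Pi.single_apply]
  · rw [hω, l2norm_eq_norm_toLp]
    simp

/-- The corner, in the lattice `r ℤ^d`, of the cell containing `v`. -/
noncomputable def gridPoint {d : ℕ} (r : ℝ) (v : Fin d → ℝ) : Fin d → ℝ :=
  fun i => r * (⌊v i / r⌋ : ℝ)

theorem measurable_gridPoint {d : ℕ} (r : ℝ) : Measurable (gridPoint (d := d) r) := by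
  unfold gridPoint
  refine measurable_pi_lambda _ fun i => ?_
  have h : Measurable fun v : Fin d → ℝ => v i / r := by fun_prop
  exact measurable_const.mul (measurable_from_top.comp h.floor)

theorem norm_sub_gridPoint_le {d : ℕ} {r : ℝ} (hr : 0 < r) (v : Fin d → ℝ) :
    ‖v - gridPoint r v‖ ≤ r := by
  refine (pi_norm_le_iff_of_nonneg hr.le).2 fun i => ?_
  have h1 := Int.floor_le (v i / r)
  have h2 := (Int.lt_floor_add_one (v i / r)).le
  rw [le_div_iff₀ hr] at h1
  rw [div_le_iff₀ hr] at h2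
  rw [Pi.sub_apply, gridPoint, Real.norm_eq_abs, abs_le]
  constructor <;> linarith

theorem le_norm_gridPoint {d : ℕ} {r : ℝ} (hr : 0 < r) {v : Fin d → ℝ} (h : gridPoint r v ≠ 0) :
    r ≤ ‖gridPoint r v‖ := by
  obtain ⟨i, hi⟩ := Function.ne_iff.1 h
  refine le_trans ?_ (norm_le_pi_norm _ i)
  have hz : ⌊v i / r⌋ ≠ 0 := by
    rintro h0
    simp [gridPoint, h0] at hi
  have : (1 : ℝ) ≤ |(⌊v i / r⌋ : ℝ)| := by exact_mod_cast Int.one_le_abs hz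
  rw [gridPoint, Real.norm_eq_abs, abs_mul, abs_of_pos hr]
  nlinarith

theorem norm_le_two_mul_norm_gridPoint {d : ℕ} {r : ℝ} (hr : 0 < r) {v : Fin d → ℝ}
    (h : gridPoint r v ≠ 0) : ‖v‖ ≤ 2 * ‖gridPoint r v‖ := by
  have h1 := norm_sub_gridPoint_le hr v
  have h2 := le_norm_gridPoint hr h
  have h3 := norm_le_norm_add_norm_sub' v (gridPoint r v)
  linarith

/-- The integral of a function that is constant on the cells of the lattice `r ℤ^d`. -/
theorem integral_comp_gridPoint {d : ℕ} {r : ℝ} (hr : 0 < r) (f : (Fin d → ℝ) → ℝ)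
    (hf : Integrable fun v => f (gridPoint r v)) :
    ∫ v, f (gridPoint r v) = ∑' y : Fin d → ℤ, r ^ d * f (r • fun i => (y i : ℝ)) := by
  let s : (Fin d → ℤ) → Set (Fin d → ℝ) := fun y =>
    Set.univ.pi fun i => Set.Ico (r * y i) (r * (y i + 1))
  have hmem : ∀ y v, v ∈ s y ↔ (fun i => ⌊v i / r⌋) = y := by
    intro y v
    simp only [s, Set.mem_univ_pi, Set.mem_Ico, funext_iff, Int.floor_eq_iff]
    simp_rw [le_div_iff₀ hr, div_lt_iff₀ hr, mul_comm r]
  have hunion : ⋃ y, s y = Set.univ :=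
    Set.eq_univ_of_forall fun v => Set.mem_iUnion.2 ⟨_, (hmem _ v).2 rfl⟩
  have hmeas : ∀ y, MeasurableSet (s y) := fun y =>
    MeasurableSet.univ_pi fun i => measurableSet_Ico
  have hdisj : Pairwise (Function.onFun Disjoint s) := fun y z hyz =>
    Set.disjoint_left.2 fun v hy hz => hyz (((hmem y v).1 hy).symm.trans ((hmem z v).1 hz))
  rw [← setIntegral_univ, ← hunion, integral_iUnion hmeas hdisj hf.integrableOn]
  refine tsum_congr fun y => ?_
  have hconst : ∀ v ∈ s y, f (gridPoint r v) = f (r • fun i => (y i : ℝ)) := by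
    intro v hv
    rw [← (hmem y v).1 hv]
    rfl
  have hvol : volume.real (s y) = r ^ d := by
    rw [Measure.real, Real.volume_pi_Ico_toReal fun i => by nlinarith]
    simp [mul_add]
  rw [setIntegral_congr_fun (hmeas y) hconst, setIntegral_const, hvol, smul_eq_mul]

theorem tendsto_gridPoint {d : ℕ} {ι : Type*} {l : Filter ι} {r : ι → ℝ} (hr : ∀ᶠ a in l, 0 < r a)
    (h0 : Tendsto r l (𝓝 0)) (v : Fin d → ℝ) :
    Tendsto (fun a => gridPoint (r a) v) l (𝓝 v) := by
  rw [tendsto_iff_norm_sub_tendsto_zero]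
  refine squeeze_zero' (.of_forall fun _ => norm_nonneg _) ?_ h0
  filter_upwards [hr] with a ha
  rw [norm_sub_rev]
  exact norm_sub_gridPoint_le ha v

/-- `waveIntegrand p ω` is continuous away from the origin, uniformly in the unit vector `ω`. -/
theorem tendsto_waveIntegrand_sub {d : ℕ} (p : ℝ) {ι : Type*} {l : Filter ι}
    {ω w : ι → Fin d → ℝ} {v : Fin d → ℝ} (hv : v ≠ 0) (hω : ∀ᶠ a in l, l2norm (ω a) = 1)
    (hw : Tendsto w l (𝓝 v)) :
    Tendsto (fun a => waveIntegrand p (ω a) (w a) - waveIntegrand p (ω a) v) l (𝓝 0) := by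
  let N : (Fin d → ℝ) → ℝ := fun x => (l2norm x ^ p)⁻¹
  have hN : Tendsto (fun a => N (w a)) l (𝓝 (N v)) := by
    have h : ContinuousAt N v :=
      (continuous_l2norm.continuousAt.rpow_const (.inl (l2norm_pos hv).ne')).inv₀
        (Real.rpow_pos_of_pos (l2norm_pos hv) p).ne'
    exact h.tendsto.comp hw
  have hlim : Tendsto (fun a => 2 * |N (w a) - N v| + l2norm (w a - v) * |N v|) l (𝓝 0) := by
    have h1 : Tendsto (fun a => |N (w a) - N v|) l (𝓝 0) := by
      simpa using (hN.sub_const (N v)).abs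
    have h2 : Tendsto (fun a => l2norm (w a - v)) l (𝓝 0) := by
      have := (continuous_l2norm.tendsto (0 : Fin d → ℝ)).comp
        (by simpa using hw.sub_const v : Tendsto (fun a => w a - v) l (𝓝 0))
      simpa [l2norm, Function.comp_def] using this
    simpa using (h1.const_mul 2).add (h2.mul_const |N v|)
  refine squeeze_zero_norm' ?_ hlim
  filter_upwards [hω] with a ha
  set A := ∑ i, ω a i * w a i
  set B := ∑ i, ω a i * v i
  have hsplit : waveIntegrand p (ω a) (w a) - waveIntegrand p (ω a) v =
      (1 - Real.cos A) * (N (w a) - N v) + (Real.cos B - Real.cos A) * N v := by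
    simp only [waveIntegrand, N, div_eq_mul_inv, A, B]
    ring
  have hA : |1 - Real.cos A| ≤ 2 := by
    rw [abs_le]
    constructor <;> linarith [Real.neg_one_le_cos A, Real.cos_le_one A]
  have hBA : |Real.cos B - Real.cos A| ≤ l2norm (w a - v) := by
    rw [abs_sub_comm]
    refine (Real.abs_cos_sub_cos_le A B).trans ?_
    have := abs_sum_mul_le_l2norm_mul (ω a) (w a - v)
    simpa [ha, A, B, mul_sub] using this
  rw [hsplit, Real.norm_eq_abs]
  refine (abs_add_le _ _).trans ?_
  rw [abs_mul, abs_mul]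
  gcongr

theorem tsum_rescaled_eq_tsum_waveIntegrand {d : ℕ} (α : ℝ) {u : Fin d → ℝ} (hu : u ≠ 0) :
    ∑' y : {y : Fin d → ℤ // y ≠ 0}, (1 - Real.cos (∑ i, u i * (y.1 i : ℝ))) /
        (zl2 y.1 ^ ((d : ℝ) + α) * l2norm u ^ α) =
      ∑' y : Fin d → ℤ, l2norm u ^ d *
        waveIntegrand (d + α) ((l2norm u)⁻¹ • u) (l2norm u • fun i => (y i : ℝ)) := by
  have hr := l2norm_pos hu
  rw [← tsum_subtype_eq_of_support_subset (s := {y : Fin d → ℤ | y ≠ 0})]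
  · refine tsum_congr fun y => ?_
    have hsum : ∑ i, ((l2norm u)⁻¹ • u) i * (l2norm u • fun i => (y.1 i : ℝ)) i =
        ∑ i, u i * (y.1 i : ℝ) := by
      refine Finset.sum_congr rfl fun i _ => ?_
      simp only [Pi.smul_apply, smul_eq_mul]
      field_simp
    rw [waveIntegrand, hsum, l2norm_smul, abs_of_pos hr, Real.mul_rpow hr.le (l2norm_nonneg _),
      Real.rpow_add hr, Real.rpow_natCast, zl2]
    field_simp
  · intro y hy h0
    refine hy ?_
    have : (l2norm u • fun i => (y i : ℝ)) = 0 := by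
      ext i
      simp [h0]
    simp only [this, waveIntegrand_zero, mul_zero]

/-- **Convergence of the rescaled symbol at the origin**: for `0 < α < 2`,
`lim_{u→0, u≠0} Σ_{y≠0} (1 − cos(u·y))/(‖y‖₂^{d+α} ‖u‖₂^α) = G̃^{d,α}`. -/
theorem rescaled_symbol_tendsto (d : ℕ) (hd : 1 ≤ d) (α : ℝ) (hα0 : 0 < α) (hα2 : α < 2) :
    Tendsto
      (fun u : Fin d → ℝ =>
        ∑' y : {y : Fin d → ℤ // y ≠ 0},
          (1 - Real.cos (∑ i, u i * (y.1 i : ℝ))) /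
            (zl2 y.1 ^ ((d : ℝ) + α) * l2norm u ^ α))
      (𝓝[≠] (0 : Fin d → ℝ)) (𝓝 (Gtilde d α)) := by
  have hβ : d + α - (1 + α / 2) < d := by linarith
  have hdR : (1 : ℝ) ≤ d := by exact_mod_cast hd
  have : NeZero d := ⟨by omega⟩
  let D : (Fin d → ℝ) → ℝ := fun v => 2 * 2 ^ ((d : ℝ) + α) *
    min (‖v‖ ^ (-((d : ℝ) + α))) (‖v‖ ^ (-((d : ℝ) + α - (1 + α / 2))))
  have hD : Integrable D := (integrable_min_norm_rpow hd (by linarith) hβ).const_mul _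
  have hne : ∀ᵐ v : Fin d → ℝ, v ≠ 0 := by simp [ae_iff]
  have hbound : ∀ {ω : Fin d → ℝ}, l2norm ω = 1 → ∀ {v w : Fin d → ℝ}, v ≠ 0 →
      (w ≠ 0 → ‖v‖ ≤ 2 * ‖w‖) → ‖waveIntegrand (d + α) ω w‖ ≤ D v := fun hω v w hv hvw => by
    rw [Real.norm_of_nonneg (waveIntegrand_nonneg _ _ _)]
    exact waveIntegrand_le_majorant (by linarith) (by linarith) (by linarith) hω hv hvw
  have hself : ∀ v : Fin d → ℝ, ‖v‖ ≤ 2 * ‖v‖ := fun v => by linarith [norm_nonneg v]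
  have hint : ∀ {ω : Fin d → ℝ}, l2norm ω = 1 → Integrable (waveIntegrand (d + α) ω) := fun hω => by
    refine hD.mono' (measurable_waveIntegrand _ _).aestronglyMeasurable ?_
    filter_upwards [hne] with v hv using hbound hω hv fun _ => hself v
  have hmeasg : ∀ (ω : Fin d → ℝ) (r : ℝ),
      Measurable fun v => waveIntegrand (d + α) ω (gridPoint r v) := fun ω r =>
    (measurable_waveIntegrand _ ω).comp (measurable_gridPoint r)
  have hintg : ∀ {ω : Fin d → ℝ}, l2norm ω = 1 → ∀ {r : ℝ}, 0 < r →
      Integrable fun v => waveIntegrand (d + α) ω (gridPoint r v) := fun hω r hr => by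
    refine hD.mono' (hmeasg _ r).aestronglyMeasurable ?_
    filter_upwards [hne] with v hv using hbound hω hv (norm_le_two_mul_norm_gridPoint hr)
  have hu : ∀ᶠ u : Fin d → ℝ in 𝓝[≠] 0, u ≠ 0 := eventually_mem_nhdsWithin
  have hr : ∀ᶠ u : Fin d → ℝ in 𝓝[≠] 0, 0 < l2norm u := hu.mono fun u h => l2norm_pos h
  have hω : ∀ᶠ u : Fin d → ℝ in 𝓝[≠] 0, l2norm ((l2norm u)⁻¹ • u) = 1 :=
    hu.mono fun u h => l2norm_normalize h
  have hr0 : Tendsto l2norm (𝓝[≠] (0 : Fin d → ℝ)) (𝓝 0) := by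
    have := (continuous_l2norm.tendsto (0 : Fin d → ℝ)).mono_left
      (nhdsWithin_le_nhds (s := {0}ᶜ))
    simpa [l2norm] using this
  have hdct : Tendsto (fun u : Fin d → ℝ => ∫ v,
      (waveIntegrand (d + α) ((l2norm u)⁻¹ • u) (gridPoint (l2norm u) v) -
        waveIntegrand (d + α) ((l2norm u)⁻¹ • u) v)) (𝓝[≠] 0)
      (𝓝 (∫ _ : Fin d → ℝ, (0 : ℝ))) := by
    refine tendsto_integral_filter_of_dominated_convergence (fun v => D v + D v) ?_ ?_
      (hD.add hD) ?_
    · exact .of_forall fun u =>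
        ((hmeasg _ _).sub (measurable_waveIntegrand _ _)).aestronglyMeasurable
    · filter_upwards [hr, hω] with u hru hωu
      filter_upwards [hne] with v hv
      exact (norm_sub_le _ _).trans (add_le_add
        (hbound hωu hv (norm_le_two_mul_norm_gridPoint hru)) (hbound hωu hv fun _ => hself v))
    · filter_upwards [hne] with v hv
      exact tendsto_waveIntegrand_sub _ hv hω (tendsto_gridPoint hr hr0 v)
  rw [integral_zero] at hdct
  have hlim := hdct.add_const (Gtilde d α)
  rw [zero_add] at hlim
  refine hlim.congr' ?_
  filter_upwards [hu, hr, hω] with u hu hru hωu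
  rw [integral_sub (hintg hωu hru) (hint hωu), ← Gtilde_eq_integral_waveIntegrand hd α hωu,
    sub_add_cancel, tsum_rescaled_eq_tsum_waveIntegrand α hu,
    integral_comp_gridPoint hru _ (hintg hωu hru)]
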